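/- Let A be a PFSA over a finite alphabet Σ with finite state set Q whose transition matrices T^(a) and final vector ρ have all entries strictly positive. Let h be the hidden-state map of the ReLU Elman RNN of dimension D = |Q|·|Σ| constructed so that h(w)_{(q,a)} = (if a = last symbol of w then p_A(q, w) else 0) for nonempty w and h(ε)_{(q,a)} = (if a = y₀ then λ_q else 0) for a fixed y₀ ∈ Σ, and let E be the output matrix with E_{a,(q,a'')} := ∑_{q'} T^(a)_{q,q'} for a ∈ Σ and E_{EOS,(q,a'')} := ρ_q. Then for every prefix w ∈ Σ*, every entry of E·h(w) is strictly positive, and softmax(log(E·h(w)))_ā = p_A(ā | w) for every ā ∈ Σ ∪ {EOS}, where log is applied entrywise and softmax has inverse temperature 1. Consequently, the LM p_R defined by p_R(y) := softmax(log(E h(y)))_{EOS} · ∏_{t=1}^{|y|} softmax(log(E h(y_{<t})))_{y_t} satisfies p_R(y) = p_A(y) for all y ∈ Σ*. -/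

import Mathlib

/-- A probabilistic finite-state automaton over alphabet `σ` with state set `Q`. -/
structure PFSA (σ Q : Type) [Fintype σ] [Fintype Q] where
  T : σ → Matrix Q Q ℚ
  init : Q → ℚ
  final : Q → ℚ
  T_nonneg : ∀ a q q', 0 ≤ T a q q'
  init_nonneg : ∀ q, 0 ≤ init q
  final_nonneg : ∀ q, 0 ≤ final q
  init_sum : ∑ q, init q = 1
  out_sum : ∀ q, (∑ a, ∑ q', T a q q') + final q = 1

/-- The prefix-weight row vector `h_A(y) = λᵀ T^(y₁) ⋯ T^(y_T)`. -/
def PFSA.prefixVec {σ Q : Type} [Fintype σ] [Fintype Q] (A : PFSA σ Q) (y : List σ) :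
    Q → ℚ :=
  y.foldl (fun v a => Matrix.vecMul v (A.T a)) A.init

/-- The string probability `p_A(y) = h_A(y) · ρ`. -/
def PFSA.stringProb {σ Q : Type} [Fintype σ] [Fintype Q] (A : PFSA σ Q) (y : List σ) : ℚ :=
  ∑ q, A.prefixVec y q * A.final q

/-- The prefix weight `∑_q p_A(q, y)`. -/
def PFSA.prefixWeight {σ Q : Type} [Fintype σ] [Fintype Q] (A : PFSA σ Q) (y : List σ) : ℚ :=
  ∑ q, A.prefixVec y q

/-- Conditional next-symbol probabilities; `none` plays the role of `EOS`. -/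
def PFSA.cond {σ Q : Type} [Fintype σ] [Fintype Q] (A : PFSA σ Q) (w : List σ) :
    Option σ → ℚ
  | some a => (∑ q, (∑ q', A.T a q q') * A.prefixVec w q) / A.prefixWeight w
  | none => (∑ q, A.final q * A.prefixVec w q) / A.prefixWeight w

/-- The output matrix `E`, indexed by `(Σ ∪ {EOS}) × (Q × Σ)`. -/
def PFSA.outMat {σ Q : Type} [Fintype σ] [Fintype Q] (A : PFSA σ Q) :
    Option σ → Q × σ → ℚ
  | some a, (q, _) => ∑ q', A.T a q q'
  | none, (q, _) => A.final q

/-- Softmax with inverse temperature `1` over `Σ ∪ {EOS}`. -/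
noncomputable def softmaxO {σ : Type} [Fintype σ] (x : Option σ → ℝ) (c : Option σ) : ℝ :=
  Real.exp (x c) / ∑ b, Real.exp (x b)

namespace PFSA

variable {σ Q : Type} [Fintype σ] [Fintype Q]

lemma nonempty_states (A : PFSA σ Q) : Nonempty Q := by
  by_contra hQ
  rw [not_nonempty_iff] at hQ
  simpa using A.init_sum

variable (A : PFSA σ Q)

lemma prefixVec_append_singleton (w : List σ) (a : σ) :
    A.prefixVec (w ++ [a]) = Matrix.vecMul (A.prefixVec w) (A.T a) := by
  simp [prefixVec]

lemma prefixVec_nonneg (w : List σ) (q : Q) : 0 ≤ A.prefixVec w q := by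
  induction w using List.reverseRecOn generalizing q with
  | nil => exact A.init_nonneg q
  | append_singleton w a ih =>
    rw [prefixVec_append_singleton]
    exact Finset.sum_nonneg fun q' _ => mul_nonneg (ih q') (A.T_nonneg a q' q)

lemma prefixWeight_nil : A.prefixWeight [] = 1 := A.init_sum

lemma prefixWeight_append_singleton (w : List σ) (a : σ) :
    A.prefixWeight (w ++ [a]) = ∑ q, (∑ q', A.T a q q') * A.prefixVec w q := by
  simp only [prefixWeight, prefixVec_append_singleton, Matrix.vecMul, dotProduct]
  rw [Finset.sum_comm]
  refine Finset.sum_congr rfl fun q _ => ?_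
  rw [← Finset.mul_sum, mul_comm]

lemma outMat_pos (hT : ∀ a q q', 0 < A.T a q q') (hfin : ∀ q, 0 < A.final q)
    (c : Option σ) (d : Q × σ) : 0 < A.outMat c d := by
  have := A.nonempty_states
  cases c with
  | none => exact hfin d.1
  | some a => exact Finset.sum_pos (fun q' _ => hT a d.1 q') Finset.univ_nonempty

lemma sum_mul_prefixVec_pos {w : List σ} (hw : 0 < A.prefixWeight w) {r : Q → ℚ}
    (hr : ∀ q, 0 < r q) : 0 < ∑ q, r q * A.prefixVec w q := by
  obtain ⟨q, hq, hpos⟩ := Finset.exists_lt_of_sum_lt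
    (f := fun _ : Q => (0 : ℚ)) (g := A.prefixVec w) (s := Finset.univ) (by simpa [prefixWeight] using hw)
  exact Finset.sum_pos' (fun q _ => mul_nonneg (hr q).le (A.prefixVec_nonneg w q))
    ⟨q, hq, mul_pos (hr q) hpos⟩

lemma prefixWeight_pos (hT : ∀ a q q', 0 < A.T a q q') (w : List σ) :
    0 < A.prefixWeight w := by
  have := A.nonempty_states
  induction w using List.reverseRecOn with
  | nil => simp [prefixWeight_nil]
  | append_singleton w a ih =>
    rw [prefixWeight_append_singleton]
    exact A.sum_mul_prefixVec_pos ih fun q =>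
      Finset.sum_pos (fun q' _ => hT a q q') Finset.univ_nonempty

lemma cond_eq_outMat_div (w : List σ) (c : Option σ) (s : σ) :
    A.cond w c = (∑ q, A.outMat c (q, s) * A.prefixVec w q) / A.prefixWeight w := by
  cases c <;> rfl

lemma sum_outMat (d : Q × σ) : ∑ c, A.outMat c d = 1 := by
  rw [Fintype.sum_option, add_comm]
  exact A.out_sum d.1

lemma sum_outMat_mul_prefixVec (w : List σ) (s : σ) :
    ∑ c, ∑ q, A.outMat c (q, s) * A.prefixVec w q = A.prefixWeight w := by
  rw [Finset.sum_comm]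
  simp_rw [← Finset.sum_mul, sum_outMat, one_mul]
  rfl

lemma sum_outMat_mul_of_eq_ite [DecidableEq σ] {g : Q × σ → ℚ} {v : Q → ℚ} {s : σ}
    (hg : ∀ q a, g (q, a) = if a = s then v q else 0) (c : Option σ) :
    ∑ d, A.outMat c d * g d = ∑ q, A.outMat c (q, s) * v q := by
  simp [Fintype.sum_prod_type, hg]

lemma prod_cond_take {y : List σ} (hpos : ∀ w, A.prefixWeight w ≠ 0) (n : ℕ)
    (hn : n ≤ y.length) :
    ∏ t : Fin n, A.cond (y.take t) (some (y[t]'(t.2.trans_le hn))) =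
      A.prefixWeight (y.take n) := by
  induction n with
  | zero => simp [prefixWeight_nil]
  | succ n ih =>
    rw [Fin.prod_univ_castSucc, ← List.take_append_getElem (show n < y.length from hn),
      prefixWeight_append_singleton]
    have hprod := ih (Nat.le_of_succ_le hn)
    simp only [Fin.val_castSucc, Fin.val_last, Fin.getElem_fin] at hprod ⊢
    rw [hprod, cond, mul_div_cancel₀ _ (hpos _)]

lemma cond_none_mul_prefixWeight {w : List σ} (hw : A.prefixWeight w ≠ 0) :
    A.cond w none * A.prefixWeight w = A.stringProb w := by
  rw [cond, div_mul_cancel₀ _ hw]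
  exact Finset.sum_congr rfl fun q _ => mul_comm _ _

end PFSA

lemma softmaxO_log {σ : Type} [Fintype σ] {x : Option σ → ℝ} (hx : ∀ c, 0 < x c)
    (c : Option σ) : softmaxO (fun b => Real.log (x b)) c = x c / ∑ b, x b := by
  simp only [softmaxO, Real.exp_log (hx _)]

/-- For a PFSA with strictly positive transition matrices and final
vector, with the hidden-state map `h` of the constructed Elman RNN and output matrix `E`,
every entry of `E·h(w)` is strictly positive, `softmax(log(E·h(w)))` coincides with the
conditional distribution `p_A(· | w)`, and the resulting softmax-normalized LM is weakly
equivalent to `p_A`. -/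
theorem softmax_log_elman_weak_equivalence
    (σ Q : Type) [Fintype σ] [Fintype Q] [DecidableEq σ]
    (A : PFSA σ Q)
    (hT : ∀ a q q', 0 < A.T a q q') (hfin : ∀ q, 0 < A.final q)
    (y₀ : σ) (h : List σ → Q × σ → ℚ)
    (h_nil : ∀ (q : Q) (a : σ), h [] (q, a) = if a = y₀ then A.init q else 0)
    (h_app : ∀ (w : List σ) (a : σ) (q : Q) (a' : σ),
      h (w ++ [a]) (q, a') = if a' = a then A.prefixVec (w ++ [a]) q else 0) :
    (∀ (w : List σ) (c : Option σ), 0 < ∑ d, (A.outMat c d : ℝ) * (h w d : ℝ)) ∧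
    (∀ (w : List σ) (c : Option σ),
      softmaxO (fun b => Real.log (∑ d, (A.outMat b d : ℝ) * (h w d : ℝ))) c =
        (A.cond w c : ℝ)) ∧
    (∀ y : List σ,
      softmaxO (fun b => Real.log (∑ d, (A.outMat b d : ℝ) * (h y d : ℝ))) none *
        ∏ t : Fin y.length,
          softmaxO
            (fun b => Real.log (∑ d, (A.outMat b d : ℝ) * (h (y.take t.1) d : ℝ)))
            (some (y.get t)) =
      (A.stringProb y : ℝ)) := by
  have hw := A.prefixWeight_pos hT
  have hform : ∀ w, ∃ s, ∀ q a, h w (q, a) = if a = s then A.prefixVec w q else 0 := by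
    intro w
    induction w using List.reverseRecOn with
    | nil => exact ⟨y₀, h_nil⟩
    | append_singleton w a _ => exact ⟨a, h_app w a⟩
  have hpos : ∀ (w : List σ) (c : Option σ),
      0 < ∑ d, (A.outMat c d : ℝ) * (h w d : ℝ) := by
    intro w c
    obtain ⟨s, hs⟩ := hform w
    have := A.sum_mul_prefixVec_pos (hw w) fun q => A.outMat_pos hT hfin c (q, s)
    rw [← A.sum_outMat_mul_of_eq_ite hs] at this
    exact_mod_cast this
  have hcond : ∀ (w : List σ) (c : Option σ),
      softmaxO (fun b => Real.log (∑ d, (A.outMat b d : ℝ) * (h w d : ℝ))) c =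
        (A.cond w c : ℝ) := by
    intro w c
    obtain ⟨s, hs⟩ := hform w
    rw [softmaxO_log (hpos w), A.cond_eq_outMat_div w c s, ← A.sum_outMat_mul_prefixVec w s]
    simp_rw [← A.sum_outMat_mul_of_eq_ite hs]
    push_cast
    rfl
  refine ⟨hpos, hcond, fun y => ?_⟩
  simp_rw [hcond]
  have hprod := A.prod_cond_take (fun w => (hw w).ne') y.length le_rfl
  rw [List.take_length] at hprod
  rw [← A.cond_none_mul_prefixWeight (hw y).ne', ← hprod]
  push_cast
  rfl
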